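/- Let F be the free group on a ≥ 2 generators, let r ∈ F, and let Γ = F/⟪r⟫ be the associated one-relator group, where ⟪r⟫ denotes the normal closure of r in F. If r does not lie in the commutator subgroup [F, F], then b_1(Γ; ℚ) = a − 1 and b_2(Γ; ℚ) = 0; if r ∈ [F, F] (and r ≠ 1), then b_1(Γ; ℚ) = a. Consequently, if b_2(Γ; ℚ) ≥ 1 then r lies in the commutator subgroup [F, F] and the number of generators a equals b_1(Γ; ℚ). -/

import Mathlib

/-- `bettiNumber K Γ i` is the `K`-dimension of the group cohomology `H^i(Γ; K)`
with trivial coefficients. -/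
noncomputable def bettiNumber (K : Type) [Field K] (Γ : Type) [Group Γ] (i : ℕ) : ℕ :=
  Module.finrank K (groupCohomology (Rep.trivial K Γ K) i)

namespace OneRel

/-- The homomorphism `F → ℚ` with prescribed values on generators. -/
noncomputable def ev {a : ℕ} (v : Fin a → ℚ) : FreeGroup (Fin a) →* Multiplicative ℚ :=
  FreeGroup.lift (fun i => Multiplicative.ofAdd (v i))

/-- Evaluation at `r`, as a linear functional of the values on generators. -/
noncomputable def evL {a : ℕ} (r : FreeGroup (Fin a)) : (Fin a → ℚ) →ₗ[ℚ] ℚ where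
  toFun v := (ev v r).toAdd
  map_add' v w := by
    have h : ev (v + w) = ev v * ev w := by
      ext i; simp [ev]
    rw [h]; rfl
  map_smul' c v := by
    have h : ev (c • v) = (AddMonoidHom.toMultiplicative (AddMonoidHom.mulLeft c)).comp (ev v) := by
      ext i; simp [ev]
    rw [h]; rfl

lemma evL_eq_zero_of_mem {a : ℕ} {r : FreeGroup (Fin a)}
    (hr : r ∈ commutator (FreeGroup (Fin a))) : evL r = 0 := by
  ext1 i
  ext
  have := Abelianization.commutator_subset_ker (ev (LinearMap.single ℚ (fun _ => ℚ) i 1)) hr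
  rw [MonoidHom.mem_ker] at this
  change (ev (LinearMap.single ℚ (fun _ => ℚ) i 1) r).toAdd = 0
  rw [this]; rfl

lemma evL_ne_zero_of_notMem {a : ℕ} {r : FreeGroup (Fin a)}
    (hr : r ∉ commutator (FreeGroup (Fin a))) : evL r ≠ 0 := by
  intro h0
  apply hr
  let x : FreeAbelianGroup (Fin a) := Additive.ofMul (Abelianization.of r)
  have hx : x = 0 := by
    apply (FreeAbelianGroup.equivFinsupp (Fin a)).injective
    rw [map_zero]
    ext i
    let φ : FreeGroup (Fin a) →* Multiplicative ℚ :=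
      { toFun := fun w => Multiplicative.ofAdd
          ((FreeAbelianGroup.coeff i (Additive.ofMul (Abelianization.of w) :
            FreeAbelianGroup (Fin a)) : ℤ) : ℚ)
        map_one' := by
          have h := map_zero (FreeAbelianGroup.coeff i)
          exact congrArg (fun n : ℤ => Multiplicative.ofAdd (n : ℚ)) h |>.trans (by simp)
        map_mul' := fun x y => by
          have h := map_add (FreeAbelianGroup.coeff i)
            (Additive.ofMul (Abelianization.of x) : FreeAbelianGroup (Fin a))
            (Additive.ofMul (Abelianization.of y) : FreeAbelianGroup (Fin a))
          refine (congrArg (fun n : ℤ => Multiplicative.ofAdd (n : ℚ)) h).trans ?_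
          exact congrArg Multiplicative.ofAdd (Int.cast_add _ _) }
    have hφ : φ = ev (Pi.single i 1) := by
      ext j
      change ((FreeAbelianGroup.coeff i (FreeAbelianGroup.of j) : ℤ) : ℚ)
        = (ev (Pi.single i 1) (FreeGroup.of j)).toAdd
      simp only [FreeAbelianGroup.coeff, ev, FreeGroup.lift_apply_of, toAdd_ofAdd,
        AddMonoidHom.comp_apply, FreeAbelianGroup.toFinsupp_of, Finsupp.applyAddHom_apply]
      by_cases hij : i = j
      · subst hij; simp
      · simp [hij, Ne.symm hij]
    have h1 : (φ r).toAdd = 0 := by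
      rw [hφ]; exact congrArg (fun f => f (Pi.single i 1)) h0
    have h2 : ((FreeAbelianGroup.coeff i x : ℤ) : ℚ) = 0 := h1
    exact_mod_cast h2
  have hx' : (Abelianization.of r) = 1 := hx
  rwa [← MonoidHom.mem_ker, Abelianization.ker_of] at hx'

/-- `Hom(Γ, ℚ)` is the kernel of evaluation at `r`. -/
noncomputable def homEquiv {a : ℕ} (r : FreeGroup (Fin a)) :
    (Additive (PresentedGroup ({r} : Set (FreeGroup (Fin a)))) →+ ℚ) ≃ₗ[ℚ]
      LinearMap.ker (evL r) := by
  have key : ∀ f : Additive (PresentedGroup ({r} : Set (FreeGroup (Fin a)))) →+ ℚ,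
      ev (fun i => f (Additive.ofMul (PresentedGroup.of i))) =
        (AddMonoidHom.toMultiplicativeRight f).comp (PresentedGroup.mk _) := by
    intro f; ext i; simp [ev]; rfl
  have mem : ∀ f : Additive (PresentedGroup ({r} : Set (FreeGroup (Fin a)))) →+ ℚ,
      (fun i => f (Additive.ofMul (PresentedGroup.of i))) ∈ LinearMap.ker (evL r) := by
    intro f
    rw [LinearMap.mem_ker]
    change (ev _ r).toAdd = 0
    rw [key, MonoidHom.comp_apply, PresentedGroup.one_of_mem (Set.mem_singleton r), map_one]
    rfl
  refine LinearEquiv.ofBijective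
    { toFun := fun f => ⟨fun i => f (Additive.ofMul (PresentedGroup.of i)), mem f⟩
      map_add' := fun f g => rfl
      map_smul' := fun c f => rfl } ⟨?_, ?_⟩
  · intro f g h
    have h' : (fun i => f (Additive.ofMul (PresentedGroup.of i))) =
      fun i => g (Additive.ofMul (PresentedGroup.of i)) := congrArg Subtype.val h
    have hh := (key f).symm.trans ((congrArg ev h').trans (key g))
    refine AddMonoidHom.ext fun x => ?_
    obtain ⟨w, hw⟩ := PresentedGroup.mk_surjective _ x.toMul
    obtain rfl : x = Additive.ofMul (PresentedGroup.mk _ w) := hw.symm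
    exact congrArg Multiplicative.toAdd (DFunLike.congr_fun hh w)
  · rintro ⟨v, hv⟩
    have hv' : ∀ s ∈ ({r} : Set (FreeGroup (Fin a))),
        FreeGroup.lift (fun i => Multiplicative.ofAdd (v i)) s = 1 := by
      rintro s rfl
      exact hv
    refine ⟨MonoidHom.toAdditiveLeft (PresentedGroup.toGroup hv'), ?_⟩
    apply Subtype.ext
    funext i
    exact congrArg Multiplicative.toAdd (PresentedGroup.toGroup.of hv')

lemma betti_one {a : ℕ} (r : FreeGroup (Fin a)) :
    bettiNumber ℚ (PresentedGroup ({r} : Set (FreeGroup (Fin a)))) 1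
      = Module.finrank ℚ (LinearMap.ker (evL r)) := by
  unfold bettiNumber
  exact LinearEquiv.finrank_eq ((groupCohomology.H1IsoOfIsTrivial
    (Rep.trivial ℚ (PresentedGroup ({r} : Set (FreeGroup (Fin a)))) ℚ)).toLinearEquiv.trans
    (homEquiv r))

/-- The central extension of `G` by `ℚ` attached to a 2-cocycle `c`. -/
@[ext] structure Ext {G : Type} (c : G × G → ℚ) where
  /-- base component -/
  base : G
  /-- fibre component -/
  fib : ℚ

/-- The group structure on the extension. -/
@[reducible] def Ext.group {G : Type} [Group G] (c : G × G → ℚ)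
    (hc : ∀ g h j : G, c (g * h, j) + c (g, h) = c (h, j) + c (g, h * j)) : Group (Ext c) :=
  letI : Mul (Ext c) := ⟨fun x y => ⟨x.base * y.base, x.fib + y.fib + c (x.base, y.base)⟩⟩
  letI : One (Ext c) := ⟨⟨1, - c (1, 1)⟩⟩
  letI : Inv (Ext c) := ⟨fun x => ⟨x.base⁻¹, - x.fib - c (x.base⁻¹, x.base) - c (1, 1)⟩⟩
  Group.ofLeftAxioms
    (by
      intro x y z
      apply Ext.ext
      · exact mul_assoc _ _ _
      · change x.fib + y.fib + c (x.base, y.base) + z.fib + c (x.base * y.base, z.base) =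
          x.fib + (y.fib + z.fib + c (y.base, z.base)) + c (x.base, y.base * z.base)
        linarith [hc x.base y.base z.base])
    (by
      intro x
      apply Ext.ext
      · exact one_mul _
      · change - c (1, 1) + x.fib + c (1, x.base) = x.fib
        have := hc 1 1 x.base
        simp only [one_mul] at this
        linarith)
    (by
      intro x
      apply Ext.ext
      · exact inv_mul_cancel _
      · change - x.fib - c (x.base⁻¹, x.base) - c (1, 1) + x.fib + c (x.base⁻¹, x.base) = - c (1, 1)
        ring)

lemma splits {a : ℕ} {r : FreeGroup (Fin a)} (hr : r ∉ commutator (FreeGroup (Fin a)))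
    (c : PresentedGroup ({r} : Set (FreeGroup (Fin a))) ×
      PresentedGroup ({r} : Set (FreeGroup (Fin a))) → ℚ)
    (hc : ∀ g h j, c (g * h, j) + c (g, h) = c (h, j) + c (g, h * j)) :
    ∃ b : PresentedGroup ({r} : Set (FreeGroup (Fin a))) → ℚ,
      ∀ g h, b (g * h) = b g + b h + c (g, h) := by
  letI := Ext.group c hc
  have mul_base : ∀ x y : Ext c, (x * y).base = x.base * y.base := fun _ _ => rfl
  have mul_fib : ∀ x y : Ext c, (x * y).fib = x.fib + y.fib + c (x.base, y.base) :=
    fun _ _ => rfl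
  have one_base : (1 : Ext c).base = 1 := rfl
  have one_fib : (1 : Ext c).fib = - c (1, 1) := rfl
  let φ : FreeGroup (Fin a) →* Ext c := FreeGroup.lift (fun i => ⟨PresentedGroup.of i, 0⟩)
  let p : Ext c →* PresentedGroup ({r} : Set (FreeGroup (Fin a))) :=
    { toFun := Ext.base, map_one' := rfl, map_mul' := fun _ _ => rfl }
  have hp : p.comp φ = PresentedGroup.mk _ := by
    ext i; simp only [φ, MonoidHom.comp_apply, FreeGroup.lift_apply_of]; rfl
  have hφ : ∀ w, (φ w).base = PresentedGroup.mk _ w := fun w => DFunLike.congr_fun hp w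
  obtain ⟨v, hv⟩ := LinearMap.surjective (evL_ne_zero_of_notMem hr) (- (φ r).fib - c (1, 1))
  let ψ : FreeGroup (Fin a) →* Ext c :=
    { toFun := fun w => ⟨(φ w).base, (φ w).fib + (ev v w).toAdd⟩
      map_one' := by
        apply Ext.ext <;> simp [one_base, one_fib]
      map_mul' := fun x y => by
        apply Ext.ext
        · simp [mul_base]
        · simp only [map_mul, mul_fib, toAdd_mul]; ring }
  have hψr : ψ r = 1 := by
    apply Ext.ext
    · change (φ r).base = 1
      rw [hφ]; exact PresentedGroup.one_of_mem (Set.mem_singleton r)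
    · change (φ r).fib + evL r v = - c (1, 1)
      rw [hv]; ring
  have hker : Subgroup.normalClosure ({r} : Set (FreeGroup (Fin a))) ≤ ψ.ker := by
    apply Subgroup.normalClosure_le_normal
    rintro s rfl
    exact hψr
  let s : PresentedGroup ({r} : Set (FreeGroup (Fin a))) →* Ext c :=
    QuotientGroup.lift _ ψ (fun x hx => hker hx)
  have hs : ∀ g, (s g).base = g := by
    intro g
    obtain ⟨w, rfl⟩ := PresentedGroup.mk_surjective _ g
    exact hφ w
  refine ⟨fun g => (s g).fib, fun g h => ?_⟩
  simp only [map_mul, mul_fib, hs]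

lemma betti_two {a : ℕ} {r : FreeGroup (Fin a)} (hr : r ∉ commutator (FreeGroup (Fin a))) :
    bettiNumber ℚ (PresentedGroup ({r} : Set (FreeGroup (Fin a)))) 2 = 0 := by
  unfold bettiNumber
  have : Subsingleton (groupCohomology
      (Rep.trivial ℚ (PresentedGroup ({r} : Set (FreeGroup (Fin a)))) ℚ) 2) := by
    apply subsingleton_of_forall_eq 0
    intro y
    induction y using groupCohomology.H2_induction_on with
    | h x =>
      rw [groupCohomology.H2π_eq_zero_iff]
      obtain ⟨b, hb⟩ := splits hr x.1 (fun g h j =>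
        (groupCohomology.mem_cocycles₂_iff x.1).1 x.2 g h j)
      refine ⟨fun g => - b g, ?_⟩
      funext ⟨g, h⟩
      rw [groupCohomology.d₁₂_hom_apply]
      change - b h - (- b (g * h)) + - b g = x.1 (g, h)
      rw [hb]; ring
  exact Module.finrank_zero_of_subsingleton

lemma betti_one_of_mem {a : ℕ} {r : FreeGroup (Fin a)}
    (hr : r ∈ commutator (FreeGroup (Fin a))) :
    bettiNumber ℚ (PresentedGroup ({r} : Set (FreeGroup (Fin a)))) 1 = a := by
  rw [betti_one, evL_eq_zero_of_mem hr, LinearMap.ker_zero, finrank_top]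
  simp

lemma betti_one_of_notMem {a : ℕ} {r : FreeGroup (Fin a)}
    (hr : r ∉ commutator (FreeGroup (Fin a))) :
    bettiNumber ℚ (PresentedGroup ({r} : Set (FreeGroup (Fin a)))) 1 = a - 1 := by
  rw [betti_one]
  have h := LinearMap.finrank_range_add_finrank_ker (evL r)
  rw [LinearMap.range_eq_top.2 (LinearMap.surjective (evL_ne_zero_of_notMem hr)),
    finrank_top] at h
  simp at h
  omega

end OneRel

/-- Betti numbers of one-relator groups `Γ = F/⟪r⟫` on `a ≥ 2` generators:
if `r ∉ [F,F]` then `b_1(Γ;ℚ) = a - 1` and `b_2(Γ;ℚ) = 0`; if `r ∈ [F,F]` and `r ≠ 1`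
then `b_1(Γ;ℚ) = a`. Consequently if `b_2(Γ;ℚ) ≥ 1` then `r ∈ [F,F]` and
`a = b_1(Γ;ℚ)`. -/
theorem betti_oneRelatorGroup (a : ℕ) (ha : 2 ≤ a) (r : FreeGroup (Fin a)) :
    (r ∉ commutator (FreeGroup (Fin a)) →
      bettiNumber ℚ (PresentedGroup ({r} : Set (FreeGroup (Fin a)))) 1 = a - 1 ∧
        bettiNumber ℚ (PresentedGroup ({r} : Set (FreeGroup (Fin a)))) 2 = 0) ∧
    (r ∈ commutator (FreeGroup (Fin a)) → r ≠ 1 →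
      bettiNumber ℚ (PresentedGroup ({r} : Set (FreeGroup (Fin a)))) 1 = a) ∧
    (1 ≤ bettiNumber ℚ (PresentedGroup ({r} : Set (FreeGroup (Fin a)))) 2 →
      r ∈ commutator (FreeGroup (Fin a)) ∧
        a = bettiNumber ℚ (PresentedGroup ({r} : Set (FreeGroup (Fin a)))) 1) := by
  refine ⟨fun hr => ⟨OneRel.betti_one_of_notMem hr, OneRel.betti_two hr⟩,
    fun hr _ => OneRel.betti_one_of_mem hr, fun h => ?_⟩
  by_cases hr : r ∈ commutator (FreeGroup (Fin a))
  · exact ⟨hr, (OneRel.betti_one_of_mem hr).symm⟩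
  · rw [OneRel.betti_two hr] at h
    omega
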